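/- Let φ = c₁ ∧ ⋯ ∧ c_m be a 3CNF formula over variables x₁,…,x_n (each clause a disjunction of at most 3 literals), and let M_φ be the HMM constructed from φ. Then φ is satisfiable if and only if there exists a trace τ ∈ L(M_φ) of length 2n+3 such that every path of M_φ of length 2n+3 generating τ ends in the state t; equivalently, R(τ) = 1. Moreover, the witnessing traces are exactly the traces # · # · α(x₁) · # · α(x₂) · # ⋯ α(x_n) · # · # for satisfying assignments α : {x₁,…,x_n} → {⊤,⊥}. -/

import Mathlib

open scoped Classical
open Finset

noncomputable section

/-- A (risk-labelled) hidden Markov model: initial state, transition matrix,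
observation function and risk function.  Stochasticity of the transition
matrix is recorded by the separate predicate `HMM.Stochastic`. -/
structure HMM (S Z : Type) where
  init : S
  P : S → S → NNReal
  obs : S → Z
  r : S → NNReal

namespace HMM

variable {S Z : Type} [Fintype S]

/-- The transition function is a probability distribution in every state. -/
def Stochastic (M : HMM S Z) : Prop := ∀ s : S, ∑ s' : S, M.P s s' = 1

/-- Probability of a path of length `n+1` (a product of `n` transition probabilities). -/
def pathProb (M : HMM S Z) {n : ℕ} (π : Fin (n + 1) → S) : NNReal :=
  ∏ i : Fin n, M.P (π i.castSucc) (π i.succ)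

/-- Paths of length `n+1`: state sequences starting in the initial state. -/
def paths (M : HMM S Z) (n : ℕ) : Finset (Fin (n + 1) → S) :=
  Finset.univ.filter fun π => π 0 = M.init

/-- The trace (observation sequence) of a path. -/
def trace (M : HMM S Z) {n : ℕ} (π : Fin (n + 1) → S) : Fin (n + 1) → Z :=
  fun i => M.obs (π i)

/-- Probability of a trace: the total probability of the paths generating it. -/
def traceProb (M : HMM S Z) {n : ℕ} (τ : Fin (n + 1) → Z) : NNReal :=
  ∑ π ∈ M.paths n, if M.trace π = τ then M.pathProb π else 0

/-- Conditional probability `Pr(π | τ)` (by `NNReal` conventions this is `0`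
whenever `Pr(τ) = 0`). -/
def condProb (M : HMM S Z) {n : ℕ} (π : Fin (n + 1) → S) (τ : Fin (n + 1) → Z) : NNReal :=
  if M.trace π = τ then M.pathProb π / M.traceProb τ else 0

/-- A trace belongs to the language of the HMM iff it has positive probability. -/
def InLang (M : HMM S Z) {n : ℕ} (τ : Fin (n + 1) → Z) : Prop := 0 < M.traceProb τ

/-- The risk of a trace: expected risk of the last state, conditioned on the trace. -/
def traceRisk (M : HMM S Z) {n : ℕ} (τ : Fin (n + 1) → Z) : NNReal :=
  ∑ π ∈ M.paths n, M.condProb π τ * M.r (π (Fin.last n))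

/-- Unsafe traces of length at most `h`, as words over `Z`. -/
def UnsafeSet (M : HMM S Z) (lamU : NNReal) (h : ℕ) : Set (List Z) :=
  { w | ∃ (n : ℕ) (τ : Fin (n + 1) → Z),
      w = List.ofFn τ ∧ n + 1 ≤ h ∧ M.InLang τ ∧ lamU < M.traceRisk τ }

/-- Safe traces of length at most `h`, as words over `Z`. -/
def SafeSet (M : HMM S Z) (lamS : NNReal) (h : ℕ) : Set (List Z) :=
  { w | ∃ (n : ℕ) (τ : Fin (n + 1) → Z),
      w = List.ofFn τ ∧ n + 1 ≤ h ∧ M.InLang τ ∧ M.traceRisk τ < lamS }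

end HMM

/-- The language of a DFA, as a set of words. -/
def dfaLang {Z Q : Type} (A : DFA Z Q) : Set (List Z) := { w | w ∈ A.accepts }

/-- States of the HMM `M_φ` built from a 3CNF formula with `n` variables and
`m` clauses.  `mid i j pr` is the state `s_{i+1,j}` (unprimed for `pr = false`,
primed for `pr = true`) and `lit i j pr b` is the state `s^b_{i+1,j}`
(resp. `s'^b_{i+1,j}`), where `b = true` stands for the literal value `⊤`. -/
inductive PState (n m : ℕ) : Type
  | start : PState n m
  | t : PState n m
  | f : PState n m
  | mid (i : Fin (n + 1)) (j : Fin m) (prime : Bool) : PState n m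
  | lit (i : Fin n) (j : Fin m) (prime : Bool) (b : Bool) : PState n m
deriving DecidableEq, Fintype

/-- The HMM `M_φ` of a 3CNF formula `φ`.  The formula is given by its clauses
`C j : Finset (Fin n × Bool)`, a pair `(i, b)` denoting the literal `x_i`
(for `b = true`) or `¬ x_i` (for `b = false`).  The observations are
`Option Bool`, with `none` playing the role of `#` and `some b` of `⊤`/`⊥`. -/
def satHMM (n m : ℕ) (C : Fin m → Finset (Fin n × Bool)) :
    HMM (PState n m) (Option Bool) where
  init := PState.start
  P := fun x y =>
    match x, y with
    | PState.start, PState.mid i _ pr =>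
        if (i : ℕ) = 0 ∧ pr = false then (m : NNReal)⁻¹ else 0
    | PState.mid i j pr, PState.lit i' j' pr' _ =>
        if (i' : ℕ) = (i : ℕ) ∧ j' = j ∧ pr' = pr ∧ (i : ℕ) < n then 1 / 2 else 0
    | PState.mid i _ pr, PState.t => if (i : ℕ) = n ∧ pr = true then 1 else 0
    | PState.mid i _ pr, PState.f => if (i : ℕ) = n ∧ pr = false then 1 else 0
    | PState.lit i j pr b, PState.mid i' j' pr' =>
        if (i' : ℕ) = (i : ℕ) + 1 ∧ j' = j ∧ pr' = (pr || ((i, b) ∈ C j)) then 1 else 0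
    | PState.t, PState.t => 1
    | PState.f, PState.f => 1
    | _, _ => 0
  obs := fun x =>
    match x with
    | PState.lit _ _ _ b => some b
    | _ => none
  r := fun x => match x with | PState.t => 1 | _ => 0

/-- The assignment `α` satisfies the clause `c`. -/
def SatClause {n : ℕ} (α : Fin n → Bool) (c : Finset (Fin n × Bool)) : Prop :=
  ∃ l ∈ c, α l.1 = l.2

/-- The trace `# · # · α(x₁) · # · α(x₂) · # ⋯ α(x_n) · # · #` of length `2n+3`
associated with an assignment `α`. -/
def assignTrace (n : ℕ) (α : Fin n → Bool) : Fin (2 * n + 3) → Option Bool :=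
  fun i =>
    if hi : 2 ≤ (i : ℕ) ∧ (i : ℕ) % 2 = 0 ∧ (i : ℕ) / 2 ≤ n then
      some (α ⟨(i : ℕ) / 2 - 1, by omega⟩)
    else none

/-- Some literal of clause `c` over the first `i` variables is true under `α`. -/
def prefixSat {n : ℕ} (α : Fin n → Bool) (c : Finset (Fin n × Bool)) (i : ℕ) : Bool :=
  decide (∃ l ∈ c, (l.1 : ℕ) < i ∧ α l.1 = l.2)

theorem prefixSat_zero {n : ℕ} (α : Fin n → Bool) (c : Finset (Fin n × Bool)) :
    prefixSat α c 0 = false := by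
  simp [prefixSat]

theorem prefixSat_succ {n : ℕ} (α : Fin n → Bool) (c : Finset (Fin n × Bool)) {i : ℕ}
    (hi : i < n) :
    prefixSat α c (i + 1) = (prefixSat α c i || decide ((⟨i, hi⟩, α ⟨i, hi⟩) ∈ c)) := by
  rw [Bool.eq_iff_iff]
  simp only [prefixSat, Bool.or_eq_true, decide_eq_true_eq]
  constructor
  · rintro ⟨⟨v, b⟩, hl, hlt, hα⟩
    obtain rfl : α v = b := hα
    rcases Nat.lt_succ_iff_lt_or_eq.mp hlt with h | h
    · exact Or.inl ⟨_, hl, h, rfl⟩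
    · obtain rfl : v = ⟨i, hi⟩ := Fin.ext h
      exact Or.inr hl
  · rintro (⟨l, hl, hlt, hα⟩ | h)
    · exact ⟨l, hl, by omega, hα⟩
    · exact ⟨_, h, Nat.lt_succ_self i, rfl⟩

theorem prefixSat_eq_true_iff {n : ℕ} (α : Fin n → Bool) (c : Finset (Fin n × Bool)) :
    prefixSat α c n = true ↔ SatClause α c := by
  simp [prefixSat, SatClause]

/-- The state at time `k` of the path of `satHMM` that picks the clause `j` and then reads
the assignment `α`. -/
def runState {n m : ℕ} (C : Fin m → Finset (Fin n × Bool)) (α : Fin n → Bool) (j : Fin m)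
    (k : ℕ) : PState n m :=
  if k = 0 then PState.start
  else if h : k % 2 = 1 ∧ k / 2 ≤ n then
    PState.mid ⟨k / 2, by omega⟩ j (prefixSat α (C j) (k / 2))
  else if h : 2 ≤ k ∧ k / 2 ≤ n then
    PState.lit ⟨k / 2 - 1, by omega⟩ j (prefixSat α (C j) (k / 2 - 1))
      (α ⟨k / 2 - 1, by omega⟩)
  else if prefixSat α (C j) n then PState.t else PState.f

section RunState

variable {n m : ℕ} (C : Fin m → Finset (Fin n × Bool)) (α : Fin n → Bool) (j : Fin m)

theorem runState_zero : runState C α j 0 = PState.start := by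
  simp [runState]

theorem runState_odd {i : ℕ} (hi : i ≤ n) :
    runState C α j (2 * i + 1) = PState.mid ⟨i, by omega⟩ j (prefixSat α (C j) i) := by
  have h₁ : (2 * i + 1) / 2 = i := by omega
  have h₂ : (2 * i + 1) % 2 = 1 := by omega
  simp [runState, h₁, h₂, hi]

theorem runState_even {i : ℕ} (hi : i < n) :
    runState C α j (2 * i + 2) =
      PState.lit ⟨i, hi⟩ j (prefixSat α (C j) i) (α ⟨i, hi⟩) := by
  have h₁ : (2 * i + 2) / 2 = i + 1 := by omega
  have h₂ : (2 * i + 2) % 2 = 0 := by omega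
  simp [runState, h₁, h₂, Nat.succ_le_of_lt hi]

theorem runState_last :
    runState C α j (2 * n + 2) = if prefixSat α (C j) n then PState.t else PState.f := by
  have h₁ : (2 * n + 2) / 2 = n + 1 := by omega
  simp [runState, h₁]

theorem runState_last_eq_t_iff :
    runState C α j (2 * n + 2) = PState.t ↔ SatClause α (C j) := by
  rw [runState_last, ← prefixSat_eq_true_iff]
  split <;> simp_all

/-- Every position of a path of length `2n+3` is initial, odd, even and inner, or last. -/
theorem position_cases {n k : ℕ} (hk : k < 2 * n + 3) :
    k = 0 ∨ (∃ i ≤ n, k = 2 * i + 1) ∨ (∃ i < n, k = 2 * i + 2) ∨ k = 2 * n + 2 := by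
  rcases Nat.even_or_odd' k with ⟨c, rfl | rfl⟩
  · rcases c with _ | c
    · exact Or.inl rfl
    · rcases Nat.lt_or_ge c n with h | h
      · exact Or.inr (Or.inr (Or.inl ⟨c, h, by ring⟩))
      · exact Or.inr (Or.inr (Or.inr (by omega)))
  · exact Or.inr (Or.inl ⟨c, by omega, rfl⟩)

theorem obs_runState (k : Fin (2 * n + 3)) :
    (satHMM n m C).obs (runState C α j k) = assignTrace n α k := by
  obtain ⟨k, hk⟩ := k
  rcases position_cases hk with rfl | ⟨i, hi, rfl⟩ | ⟨i, hi, rfl⟩ | rfl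
  · simp [runState_zero, satHMM, assignTrace]
  · simp [runState_odd C α j hi, satHMM, assignTrace]
  · have h₁ : (2 * i + 2) / 2 = i + 1 := by omega
    simp [runState_even C α j hi, satHMM, assignTrace, h₁, Nat.succ_le_of_lt hi]
  · have h₁ : (2 * n + 2) / 2 = n + 1 := by omega
    rw [runState_last]
    cases prefixSat α (C j) n <;> simp [satHMM, assignTrace, h₁]

theorem transition_runState_ne_zero {k : ℕ} (hk : k < 2 * n + 2) :
    (satHMM n m C).P (runState C α j k) (runState C α j (k + 1)) ≠ 0 := by
  have hm : m ≠ 0 := by have := j.isLt; omega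
  rcases position_cases (n := n) (k := k) (by omega) with
    rfl | ⟨i, hi, rfl⟩ | ⟨i, hi, rfl⟩ | rfl
  · have h := runState_odd C α j (Nat.zero_le n)
    simp only [Nat.mul_zero, Nat.zero_add] at h
    simp [runState_zero, h, satHMM, prefixSat_zero, hm]
  · rcases Nat.lt_or_eq_of_le hi with h | rfl
    · simp [runState_odd C α j hi, runState_even C α j h, satHMM, h]
    · rw [runState_odd C α j hi, runState_last]
      cases hp : prefixSat α (C j) i <;> simp [satHMM]
  · rw [runState_even C α j hi, show 2 * i + 2 + 1 = 2 * (i + 1) + 1 by ring,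
      runState_odd C α j (Nat.succ_le_of_lt hi), prefixSat_succ α (C j) hi]
    simp [satHMM]
  · omega

end RunState

section Paths

variable {n m : ℕ} {C : Fin m → Finset (Fin n × Bool)}

theorem HMM.pathProb_ne_zero_iff {S Z : Type} (M : HMM S Z) {n : ℕ} (π : Fin (n + 1) → S) :
    M.pathProb π ≠ 0 ↔ ∀ i : Fin n, M.P (π i.castSucc) (π i.succ) ≠ 0 := by
  simp [HMM.pathProb, Finset.prod_ne_zero_iff]

theorem HMM.inLang_iff {S Z : Type} [Fintype S] (M : HMM S Z) {n : ℕ} (τ : Fin (n + 1) → Z) :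
    M.InLang τ ↔ ∃ π ∈ M.paths n, M.pathProb π ≠ 0 ∧ M.trace π = τ := by
  rw [HMM.InLang, HMM.traceProb, pos_iff_ne_zero, Ne, Finset.sum_eq_zero_iff]
  push Not
  refine exists_congr fun π => and_congr_right fun _ => ?_
  rw [ne_eq, ite_eq_right_iff, Classical.not_imp, and_comm]

theorem satHMM_start_step {y : PState n m} (h : (satHMM n m C).P PState.start y ≠ 0) :
    ∃ j, y = PState.mid 0 j false := by
  cases y <;> simp [satHMM] at h
  obtain ⟨rfl, rfl, -⟩ := h
  exact ⟨_, rfl⟩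

theorem satHMM_mid_step {i : ℕ} (hi : i < n) {j : Fin m} {pr : Bool} {y : PState n m}
    (h : (satHMM n m C).P (PState.mid ⟨i, by omega⟩ j pr) y ≠ 0) :
    ∃ b, y = PState.lit ⟨i, hi⟩ j pr b := by
  cases y <;> simp [satHMM, hi.ne] at h
  obtain ⟨rfl, rfl, rfl, -⟩ := h
  exact ⟨_, rfl⟩

theorem satHMM_mid_last_step {j : Fin m} {pr : Bool} {y : PState n m}
    (h : (satHMM n m C).P (PState.mid ⟨n, by omega⟩ j pr) y ≠ 0) :
    y = if pr then PState.t else PState.f := by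
  cases y <;> simp_all [satHMM]

theorem satHMM_lit_step {i : ℕ} (hi : i < n) {j : Fin m} {pr b : Bool} {y : PState n m}
    (h : (satHMM n m C).P (PState.lit ⟨i, hi⟩ j pr b) y ≠ 0) :
    y = PState.mid ⟨i + 1, by omega⟩ j (pr || decide ((⟨i, hi⟩, b) ∈ C j)) := by
  cases y <;> simp [satHMM] at h
  grind

theorem runState_mem_paths (α : Fin n → Bool) (j : Fin m) :
    (fun k : Fin (2 * n + 3) => runState C α j k) ∈ (satHMM n m C).paths (2 * n + 2) := by
  simp [HMM.paths, runState_zero, satHMM]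

theorem pathProb_runState_ne_zero (α : Fin n → Bool) (j : Fin m) :
    (satHMM n m C).pathProb (fun k : Fin (2 * n + 2 + 1) => runState C α j k) ≠ 0 :=
  (HMM.pathProb_ne_zero_iff _ _).2 fun k => transition_runState_ne_zero C α j k.isLt

theorem trace_runState (α : Fin n → Bool) (j : Fin m) :
    (satHMM n m C).trace (fun k : Fin (2 * n + 2 + 1) => runState C α j k) =
      assignTrace n α :=
  funext fun k => obs_runState C α j k

/-- Every path of positive probability picks a clause and reads an assignment. -/
theorem exists_eq_runState {π : Fin (2 * n + 2 + 1) → PState n m}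
    (hπ : π ∈ (satHMM n m C).paths (2 * n + 2)) (hp : (satHMM n m C).pathProb π ≠ 0) :
    ∃ α j, π = fun k : Fin (2 * n + 2 + 1) => runState C α j k := by
  have h0 : π 0 = PState.start := by
    simpa [HMM.paths, satHMM] using hπ
  have step : ∀ k (hk : k < 2 * n + 2),
      (satHMM n m C).P (π ⟨k, by omega⟩) (π ⟨k + 1, by omega⟩) ≠ 0 :=
    fun k hk => (HMM.pathProb_ne_zero_iff _ _).1 hp ⟨k, hk⟩
  obtain ⟨j, h1⟩ := satHMM_start_step (C := C) (y := π ⟨1, by omega⟩)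
    (by have := step 0 (by omega); rwa [show (⟨0, by omega⟩ : Fin (2 * n + 2 + 1)) = 0 from rfl,
          h0] at this)
  let α : Fin n → Bool := fun i =>
    ((satHMM n m C).obs (π ⟨2 * i + 2, by omega⟩)).getD false
  have even_of_odd : ∀ i (hi : i < n),
      π ⟨2 * i + 1, by omega⟩ = PState.mid ⟨i, by omega⟩ j (prefixSat α (C j) i) →
      π ⟨2 * i + 2, by omega⟩ =
        PState.lit ⟨i, hi⟩ j (prefixSat α (C j) i) (α ⟨i, hi⟩) := by
    intro i hi h
    have hs := step (2 * i + 1) (by omega)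
    rw [h] at hs
    obtain ⟨b, hb⟩ := satHMM_mid_step hi hs
    have hα : α ⟨i, hi⟩ = b := by
      change ((satHMM n m C).obs (π ⟨2 * i + 1 + 1, by omega⟩)).getD false = b
      rw [hb]
      rfl
    rw [hα]
    exact hb
  have odd : ∀ i (hi : i ≤ n),
      π ⟨2 * i + 1, by omega⟩ = PState.mid ⟨i, by omega⟩ j (prefixSat α (C j) i) := by
    intro i
    induction i with
    | zero => intro _; rw [prefixSat_zero]; exact h1
    | succ i ih =>
      intro hi
      have hs := step (2 * i + 2) (by omega)
      rw [even_of_odd i hi (ih (by omega))] at hs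
      rw [prefixSat_succ α (C j) hi]
      exact satHMM_lit_step hi hs
  refine ⟨α, j, funext fun ⟨k, hk⟩ => ?_⟩
  rcases position_cases hk with rfl | ⟨i, hi, rfl⟩ | ⟨i, hi, rfl⟩ | rfl
  · exact h0.trans (runState_zero C α j).symm
  · exact (odd i hi).trans (runState_odd C α j hi).symm
  · exact (even_of_odd i hi (odd i hi.le)).trans (runState_even C α j hi).symm
  · have hs := step (2 * n + 1) (by omega)
    rw [odd n le_rfl] at hs
    exact (satHMM_mid_last_step hs).trans (runState_last C α j).symm

theorem assignTrace_injective (n : ℕ) : Function.Injective (assignTrace n) := by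
  intro α β h
  funext i
  have h₁ : (2 * (i : ℕ) + 2) / 2 = i + 1 := by omega
  have hi := congrFun h ⟨2 * i + 2, by omega⟩
  simpa [assignTrace, h₁, Nat.succ_le_of_lt i.isLt] using hi

theorem witness_iff_exists_assignTrace (hm : 0 < m) (τ : Fin (2 * n + 3) → Option Bool) :
    ((satHMM n m C).InLang τ ∧
      ∀ π ∈ (satHMM n m C).paths (2 * n + 2),
        (satHMM n m C).pathProb π ≠ 0 → (satHMM n m C).trace π = τ →
          π (Fin.last (2 * n + 2)) = PState.t) ↔
    ∃ α : Fin n → Bool, (∀ j, SatClause α (C j)) ∧ τ = assignTrace n α := by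
  constructor
  · rintro ⟨hL, hall⟩
    obtain ⟨π, hπ, hp, rfl⟩ := (HMM.inLang_iff _ _).1 hL
    obtain ⟨α, j, rfl⟩ := exists_eq_runState hπ hp
    refine ⟨α, fun j' => ?_, trace_runState α j⟩
    exact (runState_last_eq_t_iff C α j').1 <|
      hall _ (runState_mem_paths α j') (pathProb_runState_ne_zero α j')
        ((trace_runState α j').trans (trace_runState α j).symm)
  · rintro ⟨α, hα, rfl⟩
    refine ⟨(HMM.inLang_iff _ _).2 ⟨_, runState_mem_paths α ⟨0, hm⟩,
      pathProb_runState_ne_zero α _, trace_runState α _⟩, fun π hπ hp ht => ?_⟩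
    obtain ⟨β, j, rfl⟩ := exists_eq_runState hπ hp
    obtain rfl := assignTrace_injective n ((trace_runState β j).symm.trans ht)
    exact (runState_last_eq_t_iff C β j).2 (hα j)

end Paths

theorem stmt12 (n m : ℕ) (hm : 0 < m) (C : Fin m → Finset (Fin n × Bool))
    (h3 : ∀ j, (C j).card ≤ 3) :
    -- φ is satisfiable iff there is a trace of length 2n+3 in L(M_φ) all of
    -- whose generating paths end in the state t
    ((∃ α : Fin n → Bool, ∀ j, SatClause α (C j)) ↔
      (∃ τ : Fin (2 * n + 3) → Option Bool,
        (satHMM n m C).InLang τ ∧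
        ∀ π ∈ (satHMM n m C).paths (2 * n + 2),
          (satHMM n m C).pathProb π ≠ 0 → (satHMM n m C).trace π = τ →
            π (Fin.last (2 * n + 2)) = PState.t))
    -- moreover the witnessing traces are exactly the traces of satisfying assignments
    ∧ (∀ τ : Fin (2 * n + 3) → Option Bool,
        ((satHMM n m C).InLang τ ∧
          ∀ π ∈ (satHMM n m C).paths (2 * n + 2),
            (satHMM n m C).pathProb π ≠ 0 → (satHMM n m C).trace π = τ →
              π (Fin.last (2 * n + 2)) = PState.t) ↔
        (∃ α : Fin n → Bool, (∀ j, SatClause α (C j)) ∧ τ = assignTrace n α)) := by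
  refine ⟨⟨?_, ?_⟩, witness_iff_exists_assignTrace hm⟩
  · rintro ⟨α, hα⟩
    exact ⟨_, (witness_iff_exists_assignTrace hm _).2 ⟨α, hα, rfl⟩⟩
  · rintro ⟨τ, hτ⟩
    obtain ⟨α, hα, -⟩ := (witness_iff_exists_assignTrace hm τ).1 hτ
    exact ⟨α, hα⟩
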